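/- Let 𝒞 and 𝒟 be pretriangulated categories, each carrying a monoidal (tensor) structure compatible with the additive structure and a weight structure such that the unit object lies in the heart and the tensor product is weight-bi-exact (the tensor product of two objects of the class w≤0 lies in w≤0, and likewise for w≥0). Assume 𝒞 is rigid (every object has left and right duals) and that the weight structure on 𝒞 is bounded. Let Φ : 𝒞 → 𝒟 be a w-exact monoidal triangulated functor such that whenever X ∈ 𝒞^{w≤0} and Φ(X) ∈ 𝒟^{w<0} one has X ∈ 𝒞^{w<0}. Then Φ is w-conservative: for every object X, Φ(X) ∈ 𝒟^{w≤0} implies X ∈ 𝒞^{w≤0}, and Φ(X) ∈ 𝒟^{w≥0} implies X ∈ 𝒞^{w≥0}. -/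

import Mathlib

open CategoryTheory Category Limits Pretriangulated MonoidalCategory

/-- A weight structure on a pretriangulated category. -/
structure WeightStructure (C : Type*) [Category C] [HasZeroObject C] [HasShift C ℤ]
    [Preadditive C] [∀ n : ℤ, (CategoryTheory.shiftFunctor C n).Additive]
    [Pretriangulated C] [HasBinaryBiproducts C] where
  le : C → Prop
  ge : C → Prop
  le_of_isZero : ∀ X : C, IsZero X → le X
  ge_of_isZero : ∀ X : C, IsZero X → ge X
  le_of_iso : ∀ {X Y : C}, (X ≅ Y) → le X → le Y
  ge_of_iso : ∀ {X Y : C}, (X ≅ Y) → ge X → ge Y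
  le_biprod : ∀ X Y : C, le X → le Y → le (X ⊞ Y)
  ge_biprod : ∀ X Y : C, ge X → ge Y → ge (X ⊞ Y)
  le_retract : ∀ (X Y : C) (i : X ⟶ Y) (p : Y ⟶ X), i ≫ p = 𝟙 X → le Y → le X
  ge_retract : ∀ (X Y : C) (i : X ⟶ Y) (p : Y ⟶ X), i ≫ p = 𝟙 X → ge Y → ge X
  ge_shift : ∀ X : C, ge X → ge (X⟦(-1 : ℤ)⟧)
  le_shift : ∀ X : C, le X → le (X⟦(1 : ℤ)⟧)
  orth : ∀ {X Y : C}, ge X → le Y → ∀ f : X ⟶ Y⟦(1 : ℤ)⟧, f = 0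
  decomp : ∀ X : C, ∃ (A B : C) (f : B ⟶ X) (g : X ⟶ A) (h : A ⟶ B⟦(1 : ℤ)⟧),
    ge (B⟦(1 : ℤ)⟧) ∧ le A ∧ Triangle.mk f g h ∈ distTriang C

variable {C : Type*} [Category C] [HasZeroObject C] [HasShift C ℤ]
  [Preadditive C] [∀ n : ℤ, (CategoryTheory.shiftFunctor C n).Additive]
  [Pretriangulated C] [HasBinaryBiproducts C]

/-- `X ∈ 𝒞^{w≤n}`, i.e. `X⟦n⟧ ∈ 𝒞^{w≤0}`. -/
def WeightStructure.leN (w : WeightStructure C) (n : ℤ) (X : C) : Prop := w.le (X⟦n⟧)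

/-- `X ∈ 𝒞^{w≥n}`, i.e. `X⟦n⟧ ∈ 𝒞^{w≥0}`. -/
def WeightStructure.geN (w : WeightStructure C) (n : ℤ) (X : C) : Prop := w.ge (X⟦n⟧)

/-- The heart `𝒞^{w=0} = 𝒞^{w≥0} ∩ 𝒞^{w≤0}`. -/
def WeightStructure.heart (w : WeightStructure C) (X : C) : Prop := w.ge X ∧ w.le X

/-- A weight structure is bounded if every object lies in some `𝒞^{w≥n}` and some
`𝒞^{w≤m}`. -/
def WeightStructure.Bounded (w : WeightStructure C) : Prop :=
  ∀ X : C, ∃ n m : ℤ, w.geN n X ∧ w.leN m X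

namespace WeightStructure

variable (w : WeightStructure C)

lemma le_shift_nat {X : C} (hX : w.le X) (n : ℕ) : w.le (X⟦(n : ℤ)⟧) := by
  induction n with
  | zero => exact w.le_of_iso ((shiftFunctorZero' C ((0 : ℕ) : ℤ) (by simp)).symm.app X) hX
  | succ n ih =>
    exact w.le_of_iso
      ((shiftFunctorAdd' C (n : ℤ) 1 ((n + 1 : ℕ) : ℤ) (by simp)).symm.app X) (w.le_shift _ ih)

lemma le_shift_shift_iff (X : C) {a b c : ℤ} (h : a + b = c) :
    w.le (X⟦a⟧⟦b⟧) ↔ w.le (X⟦c⟧) :=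
  ⟨w.le_of_iso ((shiftFunctorAdd' C a b c h).symm.app X),
    w.le_of_iso ((shiftFunctorAdd' C a b c h).app X)⟩

lemma leN_neg_one_shift {X : C} (hX : w.le X) : w.leN (-1) (X⟦(1 : ℤ)⟧) :=
  w.le_of_iso ((shiftFunctorCompIsoId C (1 : ℤ) (-1) (by simp)).symm.app X) hX

lemma hom_eq_zero {X Y : C} (hX : w.ge X) (hY : w.leN (-1) Y) (f : X ⟶ Y) : f = 0 := by
  let e := (shiftFunctorCompIsoId C (-1 : ℤ) 1 (by simp)).app Y
  rw [← cancel_mono e.inv, zero_comp]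
  exact w.orth hX hY _

/-- An object receiving no nonzero morphism from `𝒞^{w≥0}` lies in `𝒞^{w<0}`. -/
lemma leN_neg_one_of_hom_eq_zero {Y : C} (h : ∀ (J : C), w.ge J → ∀ f : J ⟶ Y, f = 0) :
    w.leN (-1) Y := by
  obtain ⟨A, B, f, g, k, hB, hA, hT⟩ := w.decomp (Y⟦(-1 : ℤ)⟧)
  let e := (shiftFunctorCompIsoId C (-1 : ℤ) 1 (by simp)).app Y
  have hf : f = 0 := by
    apply (shiftFunctor C (1 : ℤ)).map_injective
    rw [← cancel_mono e.hom, Functor.map_zero, zero_comp]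
    exact h _ hB _
  obtain ⟨r, hr⟩ := Triangle.yoneda_exact₂ _ hT (𝟙 (Y⟦(-1 : ℤ)⟧))
    (by simp only [Triangle.mk_mor₁, hf]; exact zero_comp)
  exact w.le_retract _ A g r hr.symm hA

/-- Up to isomorphism, `X` is the middle term of a distinguished triangle `B ⟶ X ⟶ A ⟶ B⟦1⟧`
with `B ∈ 𝒞^{w≥0}` and `A ∈ 𝒞^{w<0}`. -/
lemma exists_triangle (X : C) : ∃ T ∈ distTriang C,
    w.ge T.obj₁ ∧ Nonempty (X ≅ T.obj₂) ∧ w.leN (-1) T.obj₃ := by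
  obtain ⟨A, B, f, g, k, hB, hA, hT⟩ := w.decomp (X⟦(-1 : ℤ)⟧)
  exact ⟨_, Triangle.shift_distinguished _ hT 1, hB,
    ⟨((shiftFunctorCompIsoId C (-1 : ℤ) 1 (by simp)).symm.app X)⟩, w.leN_neg_one_shift hA⟩

end WeightStructure

section Mates

variable {E E' : Type*} [Category E] [Category E'] [MonoidalCategory E] [MonoidalCategory E']

/-- If `Φ` is a monoidal functor and `Φ(h)` is a split epimorphism for some `h : B ⟶ X`, then
`Φ` sends the mates `Y ⊗ X' ⟶ Y ⊗ B'` of the right multiplication by `h` to split monomorphisms,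
where `− ⊗ X'` and `− ⊗ B'` are right adjoint to `− ⊗ X` and `− ⊗ B`. -/
lemma exists_retract_map_tensor (Φ : E ⥤ E') [Φ.Monoidal] {B B' X X' : E}
    (adjB : tensorRight B ⊣ tensorRight B') (adjX : tensorRight X ⊣ tensorRight X')
    (h : B ⟶ X) (s : Φ.obj X ⟶ Φ.obj B) (hs : s ≫ Φ.map h = 𝟙 _) (Y : E) :
    ∃ (i : Y ⊗ X' ⟶ Y ⊗ B') (p : Φ.obj (Y ⊗ B') ⟶ Φ.obj (Y ⊗ X')), Φ.map i ≫ p = 𝟙 _ := by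
  let t (V : E) : Φ.obj (V ⊗ X) ⟶ Φ.obj (V ⊗ B) :=
    Functor.OplaxMonoidal.δ Φ V X ≫ Φ.obj V ◁ s ≫ Functor.LaxMonoidal.μ Φ V B
  have t_nat {V V' : E} (a : V ⟶ V') : Φ.map (a ▷ X) ≫ t V' = t V ≫ Φ.map (a ▷ B) := by
    simp only [t, assoc, ← Functor.LaxMonoidal.μ_natural_left,
      ← Functor.OplaxMonoidal.δ_natural_left_assoc, whisker_exchange_assoc]
  have t_comp (V : E) : t V ≫ Φ.map (V ◁ h) = 𝟙 _ := by
    simp only [t, assoc, ← Functor.LaxMonoidal.μ_natural_right,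
      ← MonoidalCategory.whiskerLeft_comp_assoc, hs]
    simp
  let εB : (Y ⊗ B') ⊗ B ⟶ Y := adjB.counit.app Y
  let εX : (Y ⊗ X') ⊗ X ⟶ Y := adjX.counit.app Y
  let η (V : E) : V ⟶ (V ⊗ X) ⊗ X' := adjX.unit.app V
  let i : Y ⊗ X' ⟶ Y ⊗ B' := adjB.homEquiv (Y ⊗ X') Y ((Y ⊗ X') ◁ h ≫ εX)
  have hi : i ▷ B ≫ εB = (Y ⊗ X') ◁ h ≫ εX :=
    (adjB.homEquiv_counit (g := i)).symm.trans (Equiv.symm_apply_apply _ _)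
  have hη : i ≫ η (Y ⊗ B') = η (Y ⊗ X') ≫ (i ▷ X) ▷ X' := adjX.unit.naturality i
  have hηε : η (Y ⊗ X') ≫ εX ▷ X' = 𝟙 (Y ⊗ X') := adjX.right_triangle_components Y
  let q : Φ.obj ((Y ⊗ B') ⊗ X) ⟶ Φ.obj Y := t (Y ⊗ B') ≫ Φ.map εB
  have hq : Φ.map (i ▷ X) ≫ q = Φ.map εX := by
    rw [reassoc_of% (t_nat i), ← Φ.map_comp, hi, Φ.map_comp, reassoc_of% (t_comp (Y ⊗ X'))]
  refine ⟨i, Φ.map (η (Y ⊗ B')) ≫ Functor.OplaxMonoidal.δ Φ ((Y ⊗ B') ⊗ X) X' ≫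
    q ▷ Φ.obj X' ≫ Functor.LaxMonoidal.μ Φ Y X', ?_⟩
  rw [← Φ.map_comp_assoc, hη, Φ.map_comp, assoc, ← Functor.OplaxMonoidal.δ_natural_left_assoc,
    ← MonoidalCategory.comp_whiskerRight_assoc, hq, Functor.LaxMonoidal.μ_natural_left,
    Functor.Monoidal.δ_μ_assoc, ← Φ.map_comp, hηε, Φ.map_id]

end Mates

section Conservativity

variable {D : Type*} [Category D] [HasZeroObject D] [HasShift D ℤ]
  [Preadditive D] [∀ n : ℤ, (CategoryTheory.shiftFunctor D n).Additive]
  [Pretriangulated D] [HasBinaryBiproducts D]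

lemma WeightStructure.le_of_le_map (wC : WeightStructure C) (wD : WeightStructure D)
    (hbC : wC.Bounded) (Φ : C ⥤ D) [Φ.CommShift ℤ]
    (hkey : ∀ X : C, wC.le X → wD.leN (-1) (Φ.obj X) → wC.leN (-1) X)
    {X : C} (hX : wD.le (Φ.obj X)) : wC.le X := by
  have descend (n : ℕ) (h : wC.le (X⟦(n : ℤ)⟧)) : wC.le X := by
    induction n with
    | zero => exact wC.le_of_iso ((shiftFunctorZero' C ((0 : ℕ) : ℤ) (by simp)).app X) h
    | succ n ih =>
      refine ih ((wC.le_shift_shift_iff X (by simp)).1 (hkey _ h ?_))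
      refine wD.le_of_iso ((shiftFunctor D (-1 : ℤ)).mapIso
        ((Φ.commShiftIso ((n + 1 : ℕ) : ℤ)).symm.app X)) ?_
      exact (wD.le_shift_shift_iff (Φ.obj X) (c := (n : ℤ)) (by simp)).2 (wD.le_shift_nat hX n)
  obtain ⟨-, m, -, hm⟩ := hbC X
  refine descend m.toNat ?_
  exact (wC.le_shift_shift_iff X (a := m) (b := ((-m).toNat : ℤ)) (by omega)).1
    (wC.le_shift_nat hm _)

lemma WeightStructure.leN_neg_one_of_leN_map (wC : WeightStructure C) (wD : WeightStructure D)
    (hbC : wC.Bounded) (Φ : C ⥤ D) [Φ.CommShift ℤ]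
    (hkey : ∀ X : C, wC.le X → wD.leN (-1) (Φ.obj X) → wC.leN (-1) X)
    {X : C} (hX : wD.leN (-1) (Φ.obj X)) : wC.leN (-1) X :=
  wC.le_of_le_map wD hbC Φ hkey (wD.le_of_iso ((Φ.commShiftIso (-1 : ℤ)).symm.app X) hX)

end Conservativity

/-- Let `𝒞`, `𝒟` be monoidal pretriangulated categories with weight structures whose
units lie in the hearts and whose tensor products are weight-bi-exact. Assume `𝒞` is
rigid (encoded by duals `D X` with `− ⊗ D X` left and right adjoint to `− ⊗ X`) and its
weight structure is bounded. If `Φ : 𝒞 ⥤ 𝒟` is a w-exact monoidal triangulated functor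
such that `X ∈ 𝒞^{w≤0}` and `Φ(X) ∈ 𝒟^{w<0}` imply `X ∈ 𝒞^{w<0}`, then `Φ` is
w-conservative. -/
theorem stmt_9 {D : Type*} [Category D] [HasZeroObject D] [HasShift D ℤ]
    [Preadditive D] [∀ n : ℤ, (CategoryTheory.shiftFunctor D n).Additive]
    [Pretriangulated D] [HasBinaryBiproducts D]
    [MonoidalCategory C] [MonoidalPreadditive C]
    [MonoidalCategory D] [MonoidalPreadditive D]
    (wC : WeightStructure C) (wD : WeightStructure D)
    (hunitC : wC.heart (𝟙_ C)) (hunitD : wD.heart (𝟙_ D))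
    (hleC : ∀ X Y : C, wC.le X → wC.le Y → wC.le (X ⊗ Y))
    (hgeC : ∀ X Y : C, wC.ge X → wC.ge Y → wC.ge (X ⊗ Y))
    (hleD : ∀ X Y : D, wD.le X → wD.le Y → wD.le (X ⊗ Y))
    (hgeD : ∀ X Y : D, wD.ge X → wD.ge Y → wD.ge (X ⊗ Y))
    (Dual : C → C)
    (adj₁ : ∀ X : C, tensorRight (Dual X) ⊣ tensorRight X)
    (adj₂ : ∀ X : C, tensorRight X ⊣ tensorRight (Dual X))
    (hbC : wC.Bounded)
    (Φ : C ⥤ D) [Φ.Monoidal] [Φ.CommShift ℤ] [Φ.IsTriangulated]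
    (hwle : ∀ X : C, wC.le X → wD.le (Φ.obj X))
    (hwge : ∀ X : C, wC.ge X → wD.ge (Φ.obj X))
    (hkey : ∀ X : C, wC.le X → wD.leN (-1) (Φ.obj X) → wC.leN (-1) X) :
    ∀ X : C, (wD.le (Φ.obj X) → wC.le X) ∧ (wD.ge (Φ.obj X) → wC.ge X) := by
  refine fun X ↦ ⟨wC.le_of_le_map wD hbC Φ hkey, fun hX ↦ ?_⟩
  obtain ⟨T, hT, hB, ⟨e⟩, hA⟩ := wC.exists_triangle X
  have hA' : wD.leN (-1) (Φ.obj T.obj₃) :=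
    wD.le_of_iso ((Φ.commShiftIso (-1 : ℤ)).app T.obj₃) (hwle _ hA)
  obtain ⟨s, hs⟩ := Triangle.coyoneda_exact₂ _ (Φ.map_distinguished T hT) (𝟙 (Φ.obj T.obj₂))
    (wD.hom_eq_zero (wD.ge_of_iso (Φ.mapIso e) hX) hA' _)
  obtain ⟨i, p, hip⟩ := exists_retract_map_tensor Φ (adj₂ T.obj₁) (adj₂ T.obj₂) T.mor₁ s hs.symm
    T.obj₃
  have hAB : wC.leN (-1) (T.obj₃ ⊗ Dual T.obj₁) :=
    wC.leN_neg_one_of_hom_eq_zero fun J hJ f ↦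
      (((adj₂ T.obj₁).homEquiv J T.obj₃).symm.injective
        ((wC.hom_eq_zero (hgeC _ _ hJ hB) hA _).trans (wC.hom_eq_zero (hgeC _ _ hJ hB) hA _).symm))
  have hAX : wC.leN (-1) (T.obj₃ ⊗ Dual T.obj₂) :=
    wC.leN_neg_one_of_leN_map wD hbC Φ hkey <|
      wD.le_retract _ _ ((Φ.map i)⟦(-1 : ℤ)⟧') (p⟦(-1 : ℤ)⟧')
        (by rw [← Functor.map_comp, hip, CategoryTheory.Functor.map_id])
        (wD.le_of_iso ((Φ.commShiftIso (-1 : ℤ)).app _) (hwle _ hAB))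
  have hg : T.mor₂ = 0 := by
    rw [← cancel_epi (λ_ T.obj₂).hom]
    exact ((adj₂ T.obj₂).homEquiv (𝟙_ C) T.obj₃).injective
      ((wC.hom_eq_zero hunitC.1 hAX _).trans (wC.hom_eq_zero hunitC.1 hAX _).symm)
  obtain ⟨r, hr⟩ := Triangle.coyoneda_exact₂ _ hT (𝟙 T.obj₂) (by simp [hg])
  exact wC.ge_of_iso e.symm (wC.ge_retract _ _ r T.mor₁ hr.symm hB)
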